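/- Let g ∈ Γ be an element of infinite order. Then there exists L₁ > 0 such that for every x ∈ Γ there is y ∈ Γ with |y| ≤ L₁ and |x·y·gⁿ| ≥ |x| + |gⁿ| − L₁ for all n ∈ ℤ. -/

import Mathlib

open Filter Topology MeasureTheory
open scoped ENNReal

namespace HarmonicBoundary

variable {Γ : Type} [Group Γ]

/-- Word length of `g` with respect to a generating set `S`. -/
noncomputable def wl (S : Set Γ) (g : Γ) : ℕ :=
  sInf {n : ℕ | ∃ w : List Γ, w.length = n ∧ (∀ x ∈ w, x ∈ S) ∧ w.prod = g}

/-- Word metric `d(x,y) = |x⁻¹y|`. -/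
noncomputable def wdist (S : Set Γ) (x y : Γ) : ℕ := wl S (x⁻¹ * y)

/-- Gromov product `(x|y)_z = (d(x,z)+d(y,z)-d(x,y))/2`. -/
noncomputable def gp (S : Set Γ) (z x y : Γ) : ℝ :=
  ((wdist S x z : ℝ) + (wdist S y z : ℝ) - (wdist S x y : ℝ)) / 2

/-- `S` is a finite symmetric generating set of `Γ`. -/
def IsGenSet (S : Set Γ) : Prop :=
  S.Finite ∧ (∀ s ∈ S, s⁻¹ ∈ S) ∧ Subgroup.closure S = ⊤

/-- `Γ` is `δ`-hyperbolic with respect to the word metric of `S`: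
`(x|y) ≥ min ((x|z), (y|z)) - δ` for all `x y z`. -/
def IsHyperbolic (S : Set Γ) (δ : ℝ) : Prop :=
  0 ≤ δ ∧ ∀ x y z : Γ, min (gp S 1 x z) (gp S 1 y z) - δ ≤ gp S 1 x y

/-- `Γ` is nonelementary: it has no cyclic subgroup of finite index. -/
def Nonelementary (Γ : Type) [Group Γ] : Prop :=
  ∀ g : Γ, (Subgroup.zpowers g).index = 0

/-- A sequence converges to infinity if `(x_i|x_j) → ∞`. -/
def ConvInf (S : Set Γ) (u : ℕ → Γ) : Prop :=
  Tendsto (fun p : ℕ × ℕ => gp S 1 (u p.1) (u p.2)) atTop atTop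

/-- Two sequences converging to infinity are equivalent if `(x_i|y_j) → ∞`. -/
def EquivSeq (S : Set Γ) (u v : ℕ → Γ) : Prop :=
  Tendsto (fun p : ℕ × ℕ => gp S 1 (u p.1) (v p.2)) atTop atTop

/-- An (abstract model of the) Gromov boundary of `Γ`: the points are exactly the
classes of sequences converging to infinity, modulo the equivalence `EquivSeq`,
together with the natural left action of `Γ`. -/
structure Boundary (Γ : Type) [Group Γ] (S : Set Γ) where
  pt : Type
  cls : (ℕ → Γ) → pt
  cls_surj : ∀ ξ : pt, ∃ u : ℕ → Γ, ConvInf S u ∧ cls u = ξ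
  cls_eq : ∀ u v : ℕ → Γ, ConvInf S u → ConvInf S v → (cls u = cls v ↔ EquivSeq S u v)
  smul : Γ → pt → pt
  smul_cls : ∀ (g : Γ) (u : ℕ → Γ), ConvInf S u → smul g (cls u) = cls fun n => g * u n

/-- Extension of the Gromov product to the boundary:
`(ξ|η) = sup liminf (x_i|y_j)` over sequences representing `ξ` and `η`,
as an extended nonnegative real. -/
noncomputable def bgp {S : Set Γ} (B : Boundary Γ S) (ξ η : B.pt) : ℝ≥0∞ :=
  ⨆ (u : {u : ℕ → Γ // ConvInf S u ∧ B.cls u = ξ})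
    (v : {v : ℕ → Γ // ConvInf S v ∧ B.cls v = η}),
    Filter.liminf (fun p : ℕ × ℕ => ENNReal.ofReal (gp S 1 (u.1 p.1) (v.1 p.2))) atTop

/-- Real-valued Gromov product on the boundary (finite for `ξ ≠ η`). -/
noncomputable def bgpR {S : Set Γ} (B : Boundary Γ S) (ξ η : B.pt) : ℝ := (bgp B ξ η).toReal

/-- The canonical topology of the Gromov boundary: a set is open iff around each of
its points it contains a basic neighbourhood `V_r(p) = {q | (q|p) > r}`. -/
def btop {S : Set Γ} (B : Boundary Γ S) : TopologicalSpace B.pt where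
  IsOpen O := ∀ p ∈ O, ∃ r : ℝ≥0∞, r ≠ ⊤ ∧ {q | r < bgp B q p} ⊆ O
  isOpen_univ := fun p _ => ⟨0, ENNReal.zero_ne_top, fun q _ => trivial⟩
  isOpen_inter := by
    intro A A' hA hA' p hp
    obtain ⟨r1, hr1, h1⟩ := hA p hp.1
    obtain ⟨r2, hr2, h2⟩ := hA' p hp.2
    refine ⟨max r1 r2, (max_lt hr1.lt_top hr2.lt_top).ne, fun q hq => ?_⟩
    have hq' : max r1 r2 < bgp B q p := hq
    exact ⟨h1 (show r1 < bgp B q p from (le_max_left r1 r2).trans_lt hq'),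
      h2 (show r2 < bgp B q p from (le_max_right r1 r2).trans_lt hq')⟩
  isOpen_sUnion := by
    intro s hs p hp
    obtain ⟨t, ht, hpt⟩ := hp
    obtain ⟨r, hr, hsub⟩ := hs t ht p hpt
    exact ⟨r, hr, fun q hq => ⟨t, ht, hsub hq⟩⟩

/-- The attracting fixed point `g⁺ = lim_n gⁿ` of an (infinite order) element. -/
def plusPt {S : Set Γ} (B : Boundary Γ S) (g : Γ) : B.pt := B.cls fun n => g ^ n

/-- The repelling fixed point `g⁻ = lim_n g⁻ⁿ` of an (infinite order) element. -/
def minusPt {S : Set Γ} (B : Boundary Γ S) (g : Γ) : B.pt := B.cls fun n => g⁻¹ ^ n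

/-- A geodesic ray starting at the identity. -/
def IsGeodesicRay (S : Set Γ) (x : ℕ → Γ) : Prop :=
  x 0 = 1 ∧ ∀ m n : ℕ, wdist S (x m) (x n) = Nat.dist m n

/-- A geodesic ray from `e` to the boundary point `ξ`, i.e. an element of `[e,ξ]`. -/
def RayTo {S : Set Γ} (B : Boundary Γ S) (x : ℕ → Γ) (ξ : B.pt) : Prop :=
  IsGeodesicRay S x ∧ ConvInf S x ∧ B.cls x = ξ

/-- A geodesic segment from `x` to `y` (parametrized on `0,…,d(x,y)`),
i.e. an element of `[x,y]`. -/
def IsGeodesicSeg (S : Set Γ) (x y : Γ) (α : ℕ → Γ) : Prop :=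
  α 0 = x ∧ α (wdist S x y) = y ∧
  ∀ m n : ℕ, m ≤ wdist S x y → n ≤ wdist S x y → wdist S (α m) (α n) = Nat.dist m n

/-- The boundary "cylinder" `U(ξ,R)`: all `η` such that for every pair of geodesic
rays `x ∈ [e,ξ]`, `y ∈ [e,η]` one has `lim_n (x(n)|y(n)) > R` (the sequence
`(x(n)|y(n))` is nondecreasing, so the limit exceeds `R` iff some term does). -/
def Uset {S : Set Γ} (B : Boundary Γ S) (ξ : B.pt) (R : ℝ) : Set B.pt :=
  {η | ∀ x y : ℕ → Γ, RayTo B x ξ → RayTo B y η → ∃ n : ℕ, R < gp S 1 (x n) (y n)}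

/-- `C_r(p) = {g | (g|e)_p > r}`. -/
def Cset (S : Set Γ) (p : Γ) (r : ℝ) : Set Γ := {g | r < gp S p g 1}

/-- The `R`-neighbourhood `N(α,R)` of a geodesic segment `α ∈ [x,y]`. -/
def segN (S : Set Γ) (x y : Γ) (α : ℕ → Γ) (R : ℝ) : Set Γ :=
  {g | ∃ i ≤ wdist S x y, (wdist S g (α i) : ℝ) ≤ R}

/-- The `R`-neighbourhood `N(A,R)` of a subset `A ⊆ Γ`. -/
def setN (S : Set Γ) (A : Set Γ) (R : ℝ) : Set Γ :=
  {g | ∃ a ∈ A, (wdist S g a : ℝ) ≤ R}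

/-- `μ` is a nondegenerate probability measure on `Γ` with support contained in `S`:
nonnegative, of total mass one, supported in `S`, and the semigroup generated by its
support is the whole of `Γ`. -/
structure IsRWMeasure (S : Set Γ) (μ : Γ → ℝ) : Prop where
  nonneg : ∀ g, 0 ≤ μ g
  support_subset : ∀ g, μ g ≠ 0 → g ∈ S
  total : ∑' g : Γ, μ g = 1
  nondeg : ∀ g : Γ, ∃ l : List Γ, l ≠ [] ∧ (∀ x ∈ l, 0 < μ x) ∧ l.prod = g

open Classical in
/-- `n`-step transition probabilities `p⁽ⁿ⁾(x,y) = μ*ⁿ(x⁻¹y)` of the random walk. -/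
noncomputable def ptrans (μ : Γ → ℝ) : ℕ → Γ → Γ → ℝ
  | 0 => fun x y => if x = y then 1 else 0
  | n + 1 => fun x y => ∑' z : Γ, ptrans μ n x z * μ (z⁻¹ * y)

/-- Green function `G(x,y) = Σ_n p⁽ⁿ⁾(x,y)`. -/
noncomputable def green (μ : Γ → ℝ) (x y : Γ) : ℝ := ∑' n : ℕ, ptrans μ n x y

/-- `F(x,y) = G(x,y)/G(y,y)`, the probability that the walk from `x` ever hits `y`. -/
noncomputable def greenF (μ : Γ → ℝ) (x y : Γ) : ℝ := green μ x y / green μ y y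

/-- The Martin kernel `K(x,y) = G(x,y)/G(e,y)`. -/
noncomputable def martinK (μ : Γ → ℝ) (x y : Γ) : ℝ := green μ x y / green μ 1 y

open Classical in
/-- Transition probabilities of the walk restricted to `Δ` (killed when leaving `Δ`). -/
noncomputable def ptransR (μ : Γ → ℝ) (Δ : Set Γ) : ℕ → Γ → Γ → ℝ
  | 0 => fun x y => if x = y ∧ x ∈ Δ then 1 else 0
  | n + 1 => fun x y => if y ∈ Δ then ∑' z : Γ, ptransR μ Δ n x z * μ (z⁻¹ * y) else 0

/-- Green function `G_Δ` of the restricted walk. -/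
noncomputable def greenR (μ : Γ → ℝ) (Δ : Set Γ) (x y : Γ) : ℝ := ∑' n : ℕ, ptransR μ Δ n x y

/-- `F_Δ(x,y) = G_Δ(x,y)/G_Δ(y,y)`. -/
noncomputable def greenFR (μ : Γ → ℝ) (Δ : Set Γ) (x y : Γ) : ℝ :=
  greenR μ Δ x y / greenR μ Δ y y

/-- Generating function `G_Δ(x,y|z) = Σ_n p_Δ⁽ⁿ⁾(x,y) zⁿ`. -/
noncomputable def greenRZ (μ : Γ → ℝ) (Δ : Set Γ) (x y : Γ) (z : ℝ) : ℝ :=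
  ∑' n : ℕ, ptransR μ Δ n x y * z ^ n

/-- Spectral radius `ρ(P) = lim_n p⁽ⁿ⁾(e,e)^{1/n}` of the walk. -/
noncomputable def specRad (μ : Γ → ℝ) : ℝ :=
  Filter.limsup (fun n : ℕ => (ptrans μ n 1 1) ^ ((n : ℝ)⁻¹)) atTop

/-- `u` is harmonic on `Λ`: `Σ_h p(g,h) u(h) = u(g)` for `g ∈ Λ`, `p(g,h)=μ(g⁻¹h)`. -/
def HarmonicOn (μ : Γ → ℝ) (u : Γ → ℝ) (Λ : Set Γ) : Prop :=
  ∀ g ∈ Λ, (∑' h : Γ, μ (g⁻¹ * h) * u h) = u g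

/-- `u` vanishes at infinity on `Λ`: `u(g_n) → 0` along sequences in `Λ` with `|g_n|→∞`. -/
def VanishesAtInftyOn (S : Set Γ) (u : Γ → ℝ) (Λ : Set Γ) : Prop :=
  ∀ ε : ℝ, 0 < ε → ∃ M : ℕ, ∀ g ∈ Λ, M ≤ wl S g → |u g| ≤ ε

open Classical in
/-- `r(g) = K(g⁻¹,g⁺)` for infinite order `g`, and `r(g) = 1` for finite order `g`;
here `Kb` is the boundary extension of the Martin kernel. -/
noncomputable def rfun {S : Set Γ} (B : Boundary Γ S) (Kb : Γ → B.pt → ℝ) (g : Γ) : ℝ :=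
  if IsOfFinOrder g then 1 else Kb g⁻¹ (plusPt B g)

/-- The ratio set `r(Γ,∂Γ,ν)`: all `l ≥ 0` such that for every `ε > 0` and every
Borel `A` of positive measure there is `g ∈ Γ` such that
`{ω ∈ gA ∩ A : |d(gν)/dν(ω) − l| < ε}` has positive measure; here the
Radon–Nikodym derivative `d(gν)/dν` is the Martin kernel `Kb g`. -/
def ratioSet {S : Set Γ} (B : Boundary Γ S) [MeasurableSpace B.pt]
    (ν : Measure B.pt) (Kb : Γ → B.pt → ℝ) : Set ℝ :=
  {l : ℝ | 0 ≤ l ∧ ∀ ε : ℝ, 0 < ε → ∀ A : Set B.pt, MeasurableSet A → 0 < ν A →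
    ∃ g : Γ, 0 < ν {ω | ω ∈ A ∧ B.smul g⁻¹ ω ∈ A ∧ |Kb g ω - l| < ε}}

/-- A left invariant finitely additive mean on `Γ`; `Γ` is amenable iff one exists. -/
structure InvariantMean (Γ : Type) [Group Γ] where
  m : Set Γ → ℝ
  nonneg : ∀ A, 0 ≤ m A
  total : m Set.univ = 1
  fin_add : ∀ A B : Set Γ, Disjoint A B → m (A ∪ B) = m A + m B
  invariant : ∀ (g : Γ) (A : Set Γ), m ((g * ·) ⁻¹' A) = m A


/-- Abstract properties of the word length used in the proof. -/
structure LenData {G : Type} [Group G] (l : G → ℝ) (δ : ℝ) : Prop where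
  δ0 : 0 ≤ δ
  one : l 1 = 0
  nonneg : ∀ x, 0 ≤ l x
  inv : ∀ x, l x⁻¹ = l x
  mul : ∀ x y, l (x * y) ≤ l x + l y
  fin : ∀ K : ℝ, {x | l x ≤ K}.Finite
  geo : ∀ (x : G) (k : ℕ), (k : ℝ) ≤ l x → ∃ u, l u = k ∧ l (u⁻¹ * x) = l x - k
  hyp : ∀ a b c : G, l a + l c - l (a⁻¹ * c) ≤ l a + l b - l (a⁻¹ * b) + 2 * δ ∨
    l b + l c - l (b⁻¹ * c) ≤ l a + l b - l (a⁻¹ * b) + 2 * δ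

theorem wl_spec {G : Type} [Group G] {S : Set G} (hS : IsGenSet S) (g : G) :
    ∃ w : List G, w.length = wl S g ∧ (∀ x ∈ w, x ∈ S) ∧ w.prod = g := by
  have hne : {n : ℕ | ∃ w : List G, w.length = n ∧ (∀ x ∈ w, x ∈ S) ∧ w.prod = g}.Nonempty := by
    have hg : g ∈ Subgroup.closure S := by rw [hS.2.2]; trivial
    rw [← Subgroup.mem_toSubmonoid, Subgroup.closure_toSubmonoid] at hg
    obtain ⟨w, hw, hp⟩ := Submonoid.exists_list_of_mem_closure hg
    refine ⟨w.length, w, rfl, fun x hx => ?_, hp⟩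
    rcases hw x hx with h | h
    · exact h
    · simpa using hS.2.1 _ h
  exact Nat.sInf_mem hne

theorem wl_le {G : Type} [Group G] {S : Set G} (w : List G) (hw : ∀ x ∈ w, x ∈ S) :
    wl S w.prod ≤ w.length := Nat.sInf_le ⟨w, rfl, hw, rfl⟩

theorem wl_mul {G : Type} [Group G] {S : Set G} (hS : IsGenSet S) (x y : G) :
    wl S (x * y) ≤ wl S x + wl S y := by
  obtain ⟨w, h1, h2, h3⟩ := wl_spec hS x
  obtain ⟨v, k1, k2, k3⟩ := wl_spec hS y
  have := wl_le (S := S) (w ++ v) (by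
    intro z hz
    rcases List.mem_append.1 hz with h | h
    · exact h2 z h
    · exact k2 z h)
  rw [List.prod_append, h3, k3, List.length_append, h1, k1] at this
  exact this

theorem wl_inv_le {G : Type} [Group G] {S : Set G} (hS : IsGenSet S) (x : G) :
    wl S x⁻¹ ≤ wl S x := by
  obtain ⟨w, h1, h2, h3⟩ := wl_spec hS x
  have := wl_le (S := S) (w.map (fun x => x⁻¹)).reverse (by
    intro z hz
    simp only [List.mem_reverse, List.mem_map] at hz
    obtain ⟨a, ha, rfl⟩ := hz
    exact hS.2.1 a (h2 a ha))
  rw [← List.prod_inv_reverse, h3] at this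
  simpa [h1] using this

theorem wl_inv {G : Type} [Group G] {S : Set G} (hS : IsGenSet S) (x : G) :
    wl S x⁻¹ = wl S x := by
  refine le_antisymm (wl_inv_le hS x) ?_
  simpa using wl_inv_le hS x⁻¹

theorem wl_fin {G : Type} [Group G] {S : Set G} (hS : IsGenSet S) (n : ℕ) :
    {x : G | wl S x ≤ n}.Finite := by
  induction n with
  | zero =>
    refine (Set.finite_singleton (1 : G)).subset ?_
    intro x hx
    obtain ⟨w, h1, h2, h3⟩ := wl_spec hS x
    have hx' : wl S x = 0 := by simpa using hx
    rw [hx', List.length_eq_zero_iff] at h1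
    subst h1
    simpa using h3.symm
  | succ n ih =>
    refine (ih.union (Set.Finite.image2 (fun a b => a * b) hS.1 ih)).subset ?_
    intro x hx
    obtain ⟨w, h1, h2, h3⟩ := wl_spec hS x
    have hx' : wl S x ≤ n + 1 := hx
    cases w with
    | nil =>
      left
      change wl S x ≤ n
      rw [← h1]; simp
    | cons a w =>
      right
      refine ⟨a, h2 a (by simp), w.prod, ?_, by simpa using h3⟩
      have := wl_le (S := S) w (fun z hz => h2 z (by simp [hz]))
      change wl S w.prod ≤ n
      simp at h1
      omega

theorem wl_geo {G : Type} [Group G] {S : Set G} (hS : IsGenSet S) (x : G) (k : ℕ)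
    (hk : k ≤ wl S x) : ∃ u, wl S u = k ∧ wl S (u⁻¹ * x) + k = wl S x := by
  obtain ⟨w, h1, h2, h3⟩ := wl_spec hS x
  have ht := wl_le (S := S) (w.take k) (fun z hz => h2 z (List.mem_of_mem_take hz))
  have hd := wl_le (S := S) (w.drop k) (fun z hz => h2 z (List.mem_of_mem_drop hz))
  have hp : (w.take k).prod * (w.drop k).prod = x := by rw [List.prod_take_mul_prod_drop, h3]
  have hm := wl_mul hS (w.take k).prod (w.drop k).prod
  rw [hp] at hm
  have he : (w.take k).prod⁻¹ * x = (w.drop k).prod := by rw [← hp]; group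
  rw [List.length_take] at ht
  rw [List.length_drop] at hd
  refine ⟨(w.take k).prod, ?_, ?_⟩
  · omega
  · rw [he]; omega

theorem lenData {G : Type} [Group G] {S : Set G} {δ : ℝ} (hS : IsGenSet S)
    (hδ : IsHyperbolic S δ) : LenData (fun x : G => (wl S x : ℝ)) δ where
  δ0 := hδ.1
  one := by
    have := wl_le (S := S) ([] : List G) (by simp)
    simp at this
    simp [this]
  nonneg x := by positivity
  inv x := by simp only [wl_inv hS]
  mul x y := by exact_mod_cast wl_mul hS x y
  fin K := by
    refine (wl_fin hS ⌊K⌋₊).subset ?_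
    intro x hx
    exact Nat.le_floor hx
  geo x k hk := by
    obtain ⟨u, h1, h2⟩ := wl_geo hS x k (by exact_mod_cast hk)
    refine ⟨u, by exact_mod_cast h1, ?_⟩
    have : (wl S (u⁻¹ * x) : ℝ) + k = wl S x := by exact_mod_cast h2
    linarith
  hyp a b c := by
    have h := hδ.2 a b c
    simp only [gp, wdist, mul_one, wl_inv hS] at h
    rcases min_le_iff.1 (sub_le_iff_le_add.1 h) with h | h
    · left; linarith
    · right; linarith

namespace LenData

variable {G : Type} [Group G] {l : G → ℝ} {δ : ℝ}

/-- Four-point inequality at an arbitrary base point. -/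
theorem hyp4 (H : LenData l δ) (z a b c : G) :
    l (z⁻¹ * a) + l (z⁻¹ * c) - l (a⁻¹ * c) ≤
      l (z⁻¹ * a) + l (z⁻¹ * b) - l (a⁻¹ * b) + 2 * δ ∨
    l (z⁻¹ * b) + l (z⁻¹ * c) - l (b⁻¹ * c) ≤
      l (z⁻¹ * a) + l (z⁻¹ * b) - l (a⁻¹ * b) + 2 * δ := by
  have h := H.hyp (z⁻¹ * a) (z⁻¹ * b) (z⁻¹ * c)
  have e1 : (z⁻¹ * a)⁻¹ * (z⁻¹ * c) = a⁻¹ * c := by group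
  have e2 : (z⁻¹ * a)⁻¹ * (z⁻¹ * b) = a⁻¹ * b := by group
  have e3 : (z⁻¹ * b)⁻¹ * (z⁻¹ * c) = b⁻¹ * c := by group
  rwa [e1, e2, e3] at h

theorem symm (H : LenData l δ) (a b : G) : l (a⁻¹ * b) = l (b⁻¹ * a) := by
  rw [← H.inv]; congr 1; group

theorem tri (H : LenData l δ) (a b c : G) : l (a⁻¹ * c) ≤ l (a⁻¹ * b) + l (b⁻¹ * c) := by
  have := H.mul (a⁻¹ * b) (b⁻¹ * c)
  have e : (a⁻¹ * b) * (b⁻¹ * c) = a⁻¹ * c := by group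
  rwa [e] at this

/-- Local-to-global: a large element with little cancellation in its square has almost
additive powers. -/
theorem powers (H : LenData l δ) (h : G) (hh : l h + 3 * δ < l (h ^ 2)) :
    ∃ C : ℝ, 0 ≤ C ∧ ∀ m n : ℕ, l (h ^ m) + l (h ^ n) - C ≤ l (h ^ (m + n)) := by
  have hδ := H.δ0
  have hD0 : l (h ^ 2) ≤ l h + l h := by rw [pow_two]; exact H.mul h h
  obtain ⟨D, hD⟩ : ∃ D, D = l h - l (h ^ 2) / 2 := ⟨_, rfl⟩
  have key : ∀ i : ℕ, l h + l (h ^ (i + 1)) - l (h ^ (i + 2)) ≤ 2 * (D + δ) := by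
    intro i
    induction i with
    | zero => simp; linarith
    | succ i ih =>
      have h1 := H.hyp h h⁻¹ (h ^ (i + 2))
      have e1 : h⁻¹ * h ^ (i + 2) = h ^ (i + 1) := by rw [pow_succ' h (i + 1)]; group
      have e2 : h⁻¹ * h⁻¹ = (h ^ 2)⁻¹ := by group
      have e3 : h⁻¹⁻¹ * h ^ (i + 2) = h ^ (i + 3) := by rw [inv_inv, ← pow_succ']
      rw [e1, e2, e3, H.inv, H.inv] at h1
      change l h + l (h ^ (i + 2)) - l (h ^ (i + 3)) ≤ _
      rcases h1 with h1 | h1 <;> linarith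
  refine ⟨2 * (D + 2 * δ), by linarith, fun m n => ?_⟩
  rcases m with _ | m
  · simp [H.one]; linarith
  rcases n with _ | n
  · simp [H.one]; linarith
  have h1 := H.hyp h⁻¹ (h ^ (n + 1)) (h ^ (m + 1))⁻¹
  have e1 : h⁻¹⁻¹ * (h ^ (m + 1))⁻¹ = (h ^ m)⁻¹ := by rw [pow_succ]; group
  have e2 : h⁻¹⁻¹ * h ^ (n + 1) = h ^ (n + 2) := by rw [inv_inv, ← pow_succ']
  have e3 : (h ^ (n + 1))⁻¹ * (h ^ (m + 1))⁻¹ = (h ^ (m + 1 + (n + 1)))⁻¹ := by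
    rw [pow_add h (m + 1), mul_inv_rev]
  rw [e1, e2, e3, H.inv, H.inv, H.inv, H.inv] at h1
  have k1 := key n
  rcases h1 with h1 | h1
  · rcases m with _ | m
    · simp only [pow_zero, H.one] at h1
      simp only [zero_add, pow_one] at *
      linarith
    · have k2 := key m
      change l h + l (h ^ (m + 2)) - l (h ^ (m + 1)) ≤ _ at h1
      linarith
  · linarith

/-- Points on quasi-geodesics from `1` to `h ^ N` are close to the powers of `h`. -/
theorem near (H : LenData l δ) (h : G) (C : ℝ)
    (hC : ∀ m n : ℕ, l (h ^ m) + l (h ^ n) - C ≤ l (h ^ (m + n))) (p : G) (N : ℕ)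
    (hp : l p + l (p⁻¹ * h ^ N) ≤ l (h ^ N) + 4 * δ) :
    ∃ k : ℕ, l (p⁻¹ * h ^ k) ≤ l h + |C| + 10 * δ := by
  have hδ := H.δ0
  have hCa := le_abs_self C
  have hC0 := abs_nonneg C
  classical
  have hP : l (h ^ 0) ≤ l p := by simp [H.one, H.nonneg]
  set k := Nat.findGreatest (fun k => l (h ^ k) ≤ l p) N with hk
  have hk1 : l (h ^ k) ≤ l p :=
    Nat.findGreatest_spec (P := fun k => l (h ^ k) ≤ l p) (Nat.zero_le N) hP
  have hkN : k ≤ N := Nat.findGreatest_le N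
  have hk2 : l p ≤ l (h ^ k) + l h + 4 * δ := by
    rcases eq_or_lt_of_le hkN with e | e
    · rw [e]
      have := H.nonneg (p⁻¹ * h ^ N)
      have := H.nonneg h
      linarith
    · have := Nat.findGreatest_is_greatest (P := fun k => l (h ^ k) ≤ l p) (n := N)
        (Nat.lt_succ_self k) e
      have h2 : l (h ^ (k + 1)) ≤ l (h ^ k) + l h := by rw [pow_succ]; exact H.mul _ _
      simp only [Nat.succ_eq_add_one, not_le] at this
      linarith
  refine ⟨k, ?_⟩
  have h1 := H.hyp p (h ^ k) (h ^ N)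
  have e : (h ^ k)⁻¹ * h ^ N = h ^ (N - k) := by
    rw [inv_mul_eq_iff_eq_mul, ← pow_add, Nat.add_sub_cancel' hkN]
  have h2 := hC k (N - k)
  rw [Nat.add_sub_cancel' hkN] at h2
  rw [e] at h1
  have := H.nonneg h
  rcases h1 with h1 | h1 <;> linarith

theorem near_zpow (H : LenData l δ) (h : G) (C : ℝ)
    (hC : ∀ m n : ℕ, l (h ^ m) + l (h ^ n) - C ≤ l (h ^ (m + n))) (p : G) (N : ℤ)
    (hp : l p + l (p⁻¹ * h ^ N) ≤ l (h ^ N) + 4 * δ) :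
    ∃ k : ℤ, l (p⁻¹ * h ^ k) ≤ l h + |C| + 10 * δ := by
  rcases Int.eq_nat_or_neg N with ⟨n, rfl | rfl⟩
  · obtain ⟨k, hk⟩ := H.near h C hC p n (by simpa using hp)
    exact ⟨k, by simpa using hk⟩
  · obtain ⟨k, hk⟩ := H.near h⁻¹ C (by
      intro m n
      simp only [inv_pow, H.inv]
      exact hC m n) p n (by simpa using hp)
    exact ⟨-k, by simpa [H.inv] using hk⟩

/-- The theorem for an element with almost additive powers. -/
theorem main_h (H : LenData l δ) (h : G) (C : ℝ)
    (hC : ∀ m n : ℕ, l (h ^ m) + l (h ^ n) - C ≤ l (h ^ (m + n)))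
    (hi : (Subgroup.zpowers h).index = 0) :
    ∃ L : ℝ, ∀ x : G, ∃ y : G, l y ≤ L ∧ ∀ n : ℤ, l x + l (h ^ n) - L ≤ l (x * y * h ^ n) := by
  have hδ := H.δ0
  set K := l h + |C| + 10 * δ with hK
  have hinf : Infinite (G ⧸ Subgroup.zpowers h) := Subgroup.index_eq_zero_iff_infinite.1 hi
  obtain ⟨f⟩ : Nonempty (ℕ ↪ G ⧸ Subgroup.zpowers h) := ⟨Infinite.natEmbedding _⟩
  set y : ℕ → G := fun i => (f i).out with hy
  have hyq : ∀ i j, (y i)⁻¹ * y j ∈ Subgroup.zpowers h → i = j := by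
    intro i j hij
    have := QuotientGroup.eq.2 hij
    simp only [hy, QuotientGroup.out_eq'] at this
    exact f.injective this
  set B := (H.fin K).toFinset with hB
  set I := Finset.range (B.card + 1) with hI
  set R := ∑ i ∈ I, l (y i) with hR
  have hyR : ∀ i ∈ I, l (y i) ≤ R := fun i hi =>
    Finset.single_le_sum (f := fun i => l (y i)) (fun j _ => H.nonneg _) hi
  obtain ⟨T, hT⟩ := exists_nat_gt (R + 2 * δ)
  have hR0 : 0 ≤ R := Finset.sum_nonneg fun j _ => H.nonneg _
  refine ⟨R + 2 * T, fun x => ?_⟩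
  have main : ∃ i ∈ I, ∀ n : ℤ, l x + l (y i * h ^ n) - l (x * (y i * h ^ n)) ≤ 2 * T := by
    by_contra hcon
    push Not at hcon
    have hTx : (T : ℝ) ≤ l x⁻¹ := by
      obtain ⟨n, hn⟩ := hcon 0 (by simp [hI])
      have h1 := H.mul x⁻¹ (x * (y 0 * h ^ n))
      rw [inv_mul_cancel_left, H.inv] at h1
      rw [H.inv]; linarith
    obtain ⟨u, hu1, hu2⟩ := H.geo x⁻¹ T hTx
    have hclose : ∀ i ∈ I, ∃ k : ℤ, l (u⁻¹ * (y i * h ^ k)) ≤ K := by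
      intro i hi
      obtain ⟨n, hn⟩ := hcon i hi
      set z := y i * h ^ n with hz
      have a1 := H.hyp u z x⁻¹
      have e1 : l (z⁻¹ * x⁻¹) = l (x * z) := by rw [← H.inv]; congr 1; group
      rw [e1, hu1, hu2, H.inv] at a1
      have a2 := H.hyp4 u 1 z (y i)
      simp only [mul_one, inv_one, one_mul, H.inv] at a2
      have a3 := H.tri 1 (y i) u
      simp only [inv_one, one_mul] at a3
      rw [H.symm (y i) u] at a3
      have a4 := hyR i hi
      have a5 : l (z⁻¹ * y i) = l (h ^ n) := by
        rw [← H.inv]; congr 1; rw [hz]; group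
      rw [a5] at a2
      have a6 : l (u⁻¹ * y i) + l (u⁻¹ * z) ≤ l (h ^ n) + 4 * δ := by
        rcases a1 with a1 | a1 <;> rcases a2 with a2 | a2 <;> linarith
      obtain ⟨k, hk⟩ := H.near_zpow h C hC ((y i)⁻¹ * u) n (by
        have e2 : ((y i)⁻¹ * u)⁻¹ * h ^ n = u⁻¹ * z := by rw [hz]; group
        rw [e2, H.symm (y i) u]; exact a6)
      refine ⟨k, ?_⟩
      have e3 : ((y i)⁻¹ * u)⁻¹ * h ^ k = u⁻¹ * (y i * h ^ k) := by group
      rwa [e3] at hk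
    choose! k hk using hclose
    obtain ⟨i, hi, j, hj, hij, he⟩ := Finset.exists_ne_map_eq_of_card_lt_of_maps_to
      (s := I) (t := B) (f := fun i => u⁻¹ * (y i * h ^ k i)) (by simp [hI])
      (fun i hi => by
        have := hk i hi
        simpa [hB] using this)
    apply hij
    apply hyq
    have he' : y i * h ^ k i = y j * h ^ k j := mul_left_cancel he
    refine ⟨k i - k j, ?_⟩
    simp only [zpow_sub]
    rw [eq_inv_mul_iff_mul_eq, ← mul_assoc, he']
    group
  obtain ⟨i, hi, hn⟩ := main
  refine ⟨y i, ?_, fun n => ?_⟩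
  · have := hyR i hi
    have : (0 : ℝ) ≤ T := by positivity
    linarith
  · have h1 := hn n
    have h2 := hyR i hi
    have h3 := H.mul (y i)⁻¹ (y i * h ^ n)
    rw [inv_mul_cancel_left, H.inv] at h3
    rw [mul_assoc]
    linarith

/-- One-sided step: if `z = t q` is seen from `q` away from `P`, then there is little
cancellation at `q` between `t q` and `t⁻¹ q`. -/
theorem step (H : LenData l δ) (t P q : G) (hd : 4 * δ < l (q⁻¹ * t * q))
    (hA : 2 * l (P⁻¹ * t * P) + 2 * δ < l (q⁻¹ * P))
    (hz : l (q⁻¹ * P) + l (q⁻¹ * t * q) - l (P⁻¹ * (t * q)) ≤ 2 * δ) :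
    2 * l (q⁻¹ * t * q) - 4 * δ ≤ l (q⁻¹ * t ^ 2 * q) := by
  have hδ := H.δ0
  obtain ⟨d, hdd⟩ : ∃ d, d = l (q⁻¹ * t * q) := ⟨_, rfl⟩
  obtain ⟨a, haa⟩ : ∃ a, a = l (P⁻¹ * t * P) := ⟨_, rfl⟩
  -- distances
  have d1 : l ((t⁻¹ * q)⁻¹ * q) = d := by rw [hdd]; congr 1; group
  have d2 : l (P⁻¹ * (t⁻¹ * P)) = a := by rw [haa, ← H.inv]; congr 1; group
  have d3 : l ((t⁻¹ * q)⁻¹ * (t⁻¹ * P)) = l (q⁻¹ * P) := by congr 1; group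
  have d4 : l (q⁻¹ * (t⁻¹ * P)) = l (P⁻¹ * (t * q)) := by rw [← H.inv]; congr 1; group
  have d5 : l (q⁻¹ * (t⁻¹ * q)) = d := by rw [H.symm, d1]
  have d6 : l (q⁻¹ * (t * q)) = d := by rw [hdd, mul_assoc]
  have d7 : l ((t * q)⁻¹ * (t⁻¹ * q)) = l (q⁻¹ * t ^ 2 * q) := by
    rw [← H.inv]; congr 1; group
  have d8 : l ((t⁻¹ * q)⁻¹ * P) = l (P⁻¹ * (t⁻¹ * q)) := H.symm _ _
  have d9 : l (P⁻¹ * q) = l (q⁻¹ * P) := H.symm _ _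
  have d10 : l ((t⁻¹ * P)⁻¹ * q) = l (P⁻¹ * (t * q)) := by rw [H.symm, d4]
  have d11 : l ((t⁻¹ * P)⁻¹ * P) = a := by rw [H.symm, d2]
  have b1 := H.hyp4 (t⁻¹ * q) q (t⁻¹ * P) P
  have b2 := H.hyp4 q P (t * q) (t⁻¹ * q)
  have b3 := H.tri (t⁻¹ * q) P (t⁻¹ * P)
  rw [d1, d3, d4, d11] at b1
  rw [d5, d6, d7] at b2
  rw [d2, d3] at b3
  rw [← hdd] at hd hz ⊢
  have ha0 : 0 ≤ a := haa ▸ H.nonneg _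
  rw [← haa] at hA
  rcases b1 with b1 | b1 <;> rcases b2 with b2 | b2 <;> linarith

/-- Some conjugate of a nontrivial power of an infinite order element has almost additive
powers. -/
theorem exists_conj (H : LenData l δ) (g : G) (hg : ¬ IsOfFinOrder g) :
    ∃ (q : G) (j : ℕ), 0 < j ∧
      l (q⁻¹ * g ^ j * q) + 3 * δ < l ((q⁻¹ * g ^ j * q) ^ 2) := by
  have hδ := H.δ0
  have hinj : Function.Injective (fun n : ℕ => g ^ n) := injective_pow_iff_not_isOfFinOrder.2 hg
  set B := (H.fin (7 * δ)).toFinset with hB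
  set J := B.card with hJ
  set A := ∑ j ∈ Finset.range (J + 2), l (g ^ j) with hA
  have hAj : ∀ j < J + 2, l (g ^ j) ≤ A := fun j hj =>
    Finset.single_le_sum (f := fun j => l (g ^ j)) (fun j _ => H.nonneg _)
      (Finset.mem_range.2 hj)
  have hA0 : 0 ≤ A := Finset.sum_nonneg fun j _ => H.nonneg _
  obtain ⟨T, hT⟩ := exists_nat_gt (2 * A + 2 * δ)
  obtain ⟨n, hn⟩ : ∃ n : ℕ, 2 * (T : ℝ) < l (g ^ n) := by
    by_contra hcon
    push Not at hcon
    have : (Set.range fun n : ℕ => g ^ n).Finite := (H.fin (2 * T)).subset (by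
      rintro _ ⟨n, rfl⟩; exact hcon n)
    exact Set.infinite_range_of_injective hinj this
  have hT0 : (0 : ℝ) ≤ T := by positivity
  obtain ⟨q, hq1, hq2⟩ := H.geo (g ^ n) T (by linarith)
  obtain ⟨j, hj1, hj2, hj3⟩ : ∃ j : ℕ, 0 < j ∧ j < J + 2 ∧ 7 * δ < l (q⁻¹ * g ^ j * q) := by
    by_contra hcon
    push Not at hcon
    obtain ⟨i, hi, j, hj, hij, he⟩ := Finset.exists_ne_map_eq_of_card_lt_of_maps_to
      (s := Finset.range (J + 1)) (t := B) (f := fun i => q⁻¹ * g ^ (i + 1) * q)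
      (by simp [hJ])
      (fun i hi => by
        have := hcon (i + 1) (by omega) (by simp at hi; omega)
        simpa [hB] using this)
    apply hij
    have := hinj (mul_left_cancel (mul_right_cancel he))
    omega
  have hjA := hAj j hj2
  refine ⟨q, j, hj1, ?_⟩
  have e : (q⁻¹ * g ^ j * q) ^ 2 = q⁻¹ * (g ^ j) ^ 2 * q := by
    rw [pow_two, pow_two]; group
  rw [e]
  have hh := H.hyp4 q 1 (g ^ n) (g ^ j * q)
  have c1 : l ((g ^ n)⁻¹ * g ^ j * g ^ n) = l (g ^ j) := by
    congr 1
    rw [mul_assoc, ← pow_add, add_comm, pow_add, inv_mul_cancel_left]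
  have c2 : l (q⁻¹ * 1) = T := by rw [mul_one, H.inv, hq1]
  have c3 : l (q⁻¹ * (g ^ j * q)) = l (q⁻¹ * g ^ j * q) := by rw [mul_assoc]
  have c4 : l (1⁻¹ * g ^ n) = l (g ^ n) := by simp
  rw [c2, c3, c4, hq2] at hh
  suffices hs : 2 * l (q⁻¹ * g ^ j * q) - 4 * δ ≤ l (q⁻¹ * (g ^ j) ^ 2 * q) by linarith
  rcases hh with hh | hh
  · refine H.step (g ^ j) 1 q (by linarith) ?_ ?_
    · rw [c2]; simp only [inv_one, one_mul, mul_one]; linarith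
    · rw [c2]; linarith
  · refine H.step (g ^ j) (g ^ n) q (by linarith) ?_ ?_
    · rw [c1, hq2]; linarith
    · rw [hq2]; linarith

theorem main (H : LenData l δ) (hne : ∀ g : G, (Subgroup.zpowers g).index = 0)
    (g : G) (hg : ¬ IsOfFinOrder g) :
    ∃ L : ℝ, 0 < L ∧ ∀ x : G, ∃ y : G, l y ≤ L ∧
      ∀ n : ℤ, l x + l (g ^ n) - L ≤ l (x * y * g ^ n) := by
  obtain ⟨q, j, hj, hlt⟩ := H.exists_conj g hg
  set h := q⁻¹ * g ^ j * q with hh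
  obtain ⟨C, -, hC⟩ := H.powers h hlt
  obtain ⟨L, hL⟩ := H.main_h h C hC (hne h)
  set A := ∑ r ∈ Finset.range j, l (g ^ r) with hA
  have hAr : ∀ r < j, l (g ^ r) ≤ A := fun r hr =>
    Finset.single_le_sum (f := fun j => l (g ^ j)) (fun j _ => H.nonneg _)
      (Finset.mem_range.2 hr)
  have hA0 : 0 ≤ A := Finset.sum_nonneg fun j _ => H.nonneg _
  have hq0 := H.nonneg q
  have hL0 : 0 ≤ L := by
    obtain ⟨y, hy, -⟩ := hL 1
    exact (H.nonneg y).trans hy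
  refine ⟨L + 3 * l q + 2 * A + 1, by linarith, fun x => ?_⟩
  obtain ⟨y, hy, hn⟩ := hL x
  refine ⟨y * q⁻¹, ?_, fun n => ?_⟩
  · have := H.mul y q⁻¹
    rw [H.inv] at this
    linarith
  · obtain ⟨k, r, hr, hnk⟩ : ∃ (k : ℤ) (r : ℕ), r < j ∧ n = j * k + r := by
      have hj' : (0 : ℤ) < j := by exact_mod_cast hj
      have h1 := Int.emod_nonneg n hj'.ne'
      have h2 := Int.emod_lt_of_pos n hj'
      refine ⟨n / j, (n % j).toNat, by omega, ?_⟩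
      rw [Int.toNat_of_nonneg h1, Int.mul_ediv_add_emod]
    have hk : h ^ k = q⁻¹ * (g ^ j) ^ k * q := by
      have := conj_zpow (i := k) (a := q⁻¹) (b := g ^ j)
      simpa [hh] using this
    have hgn : g ^ n = q * h ^ k * q⁻¹ * g ^ r := by
      rw [hk, hnk, zpow_add, zpow_mul, zpow_natCast, zpow_natCast]; group
    have e1 : x * (y * q⁻¹) * g ^ n = x * y * h ^ k * (q⁻¹ * g ^ r) := by
      rw [hgn]; group
    have b1 := hn k
    have b2 := H.mul (x * y * h ^ k * (q⁻¹ * g ^ r)) (q⁻¹ * g ^ r)⁻¹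
    rw [mul_inv_cancel_right, H.inv] at b2
    have b3 := H.mul q⁻¹ (g ^ r)
    rw [H.inv] at b3
    have b4 := hAr r hr
    have b5 := H.mul (q * h ^ k * q⁻¹) (g ^ r)
    have b6 := H.mul (q * h ^ k) q⁻¹
    have b7 := H.mul q (h ^ k)
    rw [H.inv] at b6
    rw [e1]
    rw [← hgn] at b5
    linarith

end LenData

theorem word_length_almost_additive
    (Γ : Type) [Group Γ] (S : Set Γ) (δ : ℝ)
    (hS : IsGenSet S) (hδ : IsHyperbolic S δ) (hne : Nonelementary Γ)
    (g : Γ) (hg : ¬ IsOfFinOrder g) :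
    ∃ L1 : ℝ, 0 < L1 ∧ ∀ x : Γ, ∃ y : Γ, (wl S y : ℝ) ≤ L1 ∧
      ∀ n : ℤ, (wl S x : ℝ) + (wl S (g ^ n) : ℝ) - L1 ≤ (wl S (x * y * g ^ n) : ℝ) := by
  exact (lenData hS hδ).main hne g hg

end HarmonicBoundary
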